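/- Let P be a seminegative disjunctive logic program and let D_n(P) = (P_c ∪ P₋ ∪ P_p, <) be its ordered version, where P_c = {a ← β' | (α ← β) ∈ P, a ∈ α}, P₋ = {¬a ← | a ∈ H_B(P)}, P_p = {a ← β' ∪ ¬(α \ {a}) | (α ← β) ∈ P, a ∈ α}, β' is β with each not b replaced by ¬b, and P_p < P₋ < P_c. If M is an answer set of P then M ∪ ¬(H_B(P) \ M) is a proper preferred answer set of D_n(P). -/

import Mathlib

namespace ASP

/-- A literal is an atom `a` or a negated atom `¬ a`. -/
inductive Lit (α : Type) : Type where
  | pos (a : α)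
  | neg (a : α)
deriving DecidableEq

/-- Classical negation of a literal. -/
def Lit.negate {α : Type} : Lit α → Lit α
  | .pos a => .neg a
  | .neg a => .pos a

/-- The atom underlying a literal. -/
def Lit.atom {α : Type} : Lit α → α
  | .pos a => a
  | .neg a => a

/-- A rule of a simple logic program: a head which is a literal or absent
(a constraint), and a finite set of literals as body. -/
structure Rule (α : Type) [DecidableEq α] : Type where
  head : Option (Lit α)
  body : Finset (Lit α)

variable {α : Type} [DecidableEq α]

/-- A set of literals is consistent if it contains no complementary pair. -/
def Consistent (I : Set (Lit α)) : Prop :=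
  ∀ a : α, ¬(Lit.pos a ∈ I ∧ Lit.neg a ∈ I)

/-- The Herbrand base of a program: all atoms occurring in it. -/
def herbrand (P : Set (Rule α)) : Set α :=
  {a | ∃ r ∈ P, (∃ l, r.head = some l ∧ l.atom = a) ∨ (∃ l ∈ r.body, l.atom = a)}

/-- An interpretation of `P`: a consistent set of literals over the Herbrand base of `P`. -/
def IsInterp (P : Set (Rule α)) (I : Set (Lit α)) : Prop :=
  Consistent I ∧ ∀ l ∈ I, l.atom ∈ herbrand P

/-- A rule `a ← β` is satisfied by `I` if `a ∈ I` whenever `β ⊆ I`;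
a constraint `← β` is satisfied if its body is not contained in `I`. -/
def Satisfied (I : Set (Lit α)) (r : Rule α) : Prop :=
  ↑r.body ⊆ I → ∃ l, r.head = some l ∧ l ∈ I

/-- A rule is applied w.r.t. `I` if its body holds and its head literal is in `I`. -/
def Applied (I : Set (Lit α)) (r : Rule α) : Prop :=
  ↑r.body ⊆ I ∧ ∃ l, r.head = some l ∧ l ∈ I

/-- A rule `a ← β` is defeated w.r.t. `P` and `I` iff `P` contains an applied
competing rule `¬a ← β'`. -/
def Defeated (P : Set (Rule α)) (I : Set (Lit α)) (r : Rule α) : Prop :=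
  ∃ l, r.head = some l ∧ ∃ r' ∈ P, r'.head = some l.negate ∧ Applied I r'

/-- The reduct of `P` w.r.t. `I`: the rules of `P` satisfied by `I`. -/
def reduct (P : Set (Rule α)) (I : Set (Lit α)) : Set (Rule α) :=
  {r ∈ P | Satisfied I r}

/-- `star R` is the unique minimal model of `R` viewed as a positive program
(negative literals treated as fresh atoms; constraints never fire their head). -/
def star (R : Set (Rule α)) : Set (Lit α) :=
  ⋂₀ {J : Set (Lit α) | ∀ r ∈ R, ↑r.body ⊆ J → ∀ l, r.head = some l → l ∈ J}

/-- An interpretation is founded iff `(P_I)* = I`. -/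
def Founded (P : Set (Rule α)) (I : Set (Lit α)) : Prop :=
  star (reduct P I) = I

/-- A founded interpretation `M` is an extended answer set of `P` iff every rule
of `P` is satisfied or defeated w.r.t. `M`. -/
def ExtAnswerSet (P : Set (Rule α)) (M : Set (Lit α)) : Prop :=
  IsInterp P M ∧ Founded P M ∧ ∀ r ∈ P, Satisfied M r ∨ Defeated P M r

/-- An answer set of a program without negation as failure: a minimal
interpretation satisfying all rules of the program. -/
def IsAnswerSet (P : Set (Rule α)) (M : Set (Lit α)) : Prop :=
  IsInterp P M ∧ (∀ r ∈ P, Satisfied M r) ∧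
    ∀ J, IsInterp P J → (∀ r ∈ P, Satisfied J r) → ¬J ⊂ M


section OLP

variable {α : Type} [DecidableEq α]

/-- `R₁ ⊑ R₂` for sets of rules: every rule in `R₂ \ R₁` is countered by a
`<`-smaller rule in `R₁ \ R₂`. -/
def RuleSq (lt : Rule α → Rule α → Prop) (R₁ R₂ : Set (Rule α)) : Prop :=
  ∀ r₂ ∈ R₂ \ R₁, ∃ r₁ ∈ R₁ \ R₂, lt r₁ r₂

/-- `M₁ ⊑ M₂` for (extended) answer sets of an ordered program: the induced
order on their reducts. -/
def ASSq (P : Set (Rule α)) (lt : Rule α → Rule α → Prop)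
    (M₁ M₂ : Set (Lit α)) : Prop :=
  RuleSq lt (reduct P M₁) (reduct P M₂)

/-- `M₁ ⊏ M₂` iff `M₁ ⊑ M₂` and not `M₂ ⊑ M₁`. -/
def ASLt (P : Set (Rule α)) (lt : Rule α → Rule α → Prop)
    (M₁ M₂ : Set (Lit α)) : Prop :=
  ASSq P lt M₁ M₂ ∧ ¬ ASSq P lt M₂ M₁

/-- An answer set is proper iff it satisfies all `<`-minimal rules of `P`. -/
def ProperAS (P : Set (Rule α)) (lt : Rule α → Rule α → Prop)
    (M : Set (Lit α)) : Prop :=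
  ∀ r ∈ P, (∀ r' ∈ P, ¬ lt r' r) → Satisfied M r

/-- A preferred answer set of the ordered program `(P, lt)`: an extended answer
set of `P` that is `⊑`-minimal among the extended answer sets of `P`. -/
def PreferredAS (P : Set (Rule α)) (lt : Rule α → Rule α → Prop)
    (M : Set (Lit α)) : Prop :=
  ExtAnswerSet P M ∧ ∀ N, ExtAnswerSet P N → ¬ ASLt P lt N M

end OLP

section Disjunctive

variable {α : Type} [DecidableEq α]

/-- A rule of a positive disjunctive logic program: a finite set of atoms as
(disjunctive) head and a finite set of atoms as body. -/
structure DRule (α : Type) [DecidableEq α] : Type where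
  head : Finset α
  body : Finset α

/-- The Herbrand base of a positive disjunctive program. -/
def herbrandD (P : Set (DRule α)) : Set α :=
  {a | ∃ r ∈ P, a ∈ r.head ∨ a ∈ r.body}

/-- `M` is a model of the positive disjunctive program `P`. -/
def DModel (P : Set (DRule α)) (M : Set α) : Prop :=
  ∀ r ∈ P, ↑r.body ⊆ M → ∃ a ∈ r.head, a ∈ M

/-- `M` is a minimal model of the positive disjunctive program `P`. -/
def DMinModel (P : Set (DRule α)) (M : Set α) : Prop :=
  DModel P M ∧ ∀ N, DModel P N → ¬ N ⊂ M

end Disjunctive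

section SemiDisjunctive

variable {α : Type} [DecidableEq α]

/-- A rule of a seminegative disjunctive logic program: a finite set of atoms
as disjunctive head, a finite set of atoms as positive body and a finite set of
atoms occurring under negation as failure in the body. -/
structure DnRule (α : Type) [DecidableEq α] : Type where
  head : Finset α
  bodyPos : Finset α
  bodyNaf : Finset α

/-- Herbrand base of a seminegative disjunctive program. -/
def herbrandDn (P : Set (DnRule α)) : Set α :=
  {a | ∃ r ∈ P, a ∈ r.head ∨ a ∈ r.bodyPos ∨ a ∈ r.bodyNaf}

/-- Gelfond–Lifschitz reduct of a seminegative disjunctive program. -/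
def DnGLreduct (P : Set (DnRule α)) (M : Set α) : Set (DRule α) :=
  {d | ∃ r ∈ P, (∀ b ∈ r.bodyNaf, b ∉ M) ∧ d = ⟨r.head, r.bodyPos⟩}

/-- `M` is an answer set of a seminegative disjunctive program `P` iff it is a
minimal model of the reduct `P^M`. -/
def DnAnswerSet (P : Set (DnRule α)) (M : Set α) : Prop :=
  DMinModel (DnGLreduct P M) M

/-- The body `β'` of a rule: `β` with each `not b` replaced by `¬b`. -/
def DnBody (r : DnRule α) : Finset (Lit α) :=
  r.bodyPos.image Lit.pos ∪ r.bodyNaf.image Lit.neg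

/-- `P_c = {a ← β' | (α ← β) ∈ P, a ∈ α}`. -/
def DnPc (P : Set (DnRule α)) : Set (Rule α) :=
  {t | ∃ r ∈ P, ∃ a ∈ r.head, t = ⟨some (Lit.pos a), DnBody r⟩}

/-- `P₋ = {¬a ← | a ∈ H_B(P)}`. -/
def DnPminus (P : Set (DnRule α)) : Set (Rule α) :=
  {t | ∃ a ∈ herbrandDn P, t = ⟨some (Lit.neg a), ∅⟩}

/-- `P_p = {a ← β' ∪ ¬(α \ {a}) | (α ← β) ∈ P, a ∈ α}`. -/
def DnPp (P : Set (DnRule α)) : Set (Rule α) :=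
  {t | ∃ r ∈ P, ∃ a ∈ r.head,
    t = ⟨some (Lit.pos a), DnBody r ∪ (r.head.erase a).image Lit.neg⟩}

/-- The program of the ordered version `D_n(P) = (P_c ∪ P₋ ∪ P_p, <)`. -/
def DnProg (P : Set (DnRule α)) : Set (Rule α) :=
  DnPc P ∪ DnPminus P ∪ DnPp P

/-- The order of `D_n(P)`: `P_p < P₋ < P_c`. -/
def Dnlt (P : Set (DnRule α)) : Rule α → Rule α → Prop :=
  fun r₁ r₂ =>
    (r₁ ∈ DnPp P ∧ (r₂ ∈ DnPminus P ∨ r₂ ∈ DnPc P)) ∨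
    (r₁ ∈ DnPminus P ∧ r₂ ∈ DnPc P)

end SemiDisjunctive

section Completion

variable {α : Type} [DecidableEq α]

/-- The total interpretation `X ∪ ¬(H_B(P) \ X)` determined by a set of atoms `X`. -/
def completion (P : Set (DnRule α)) (X : Set α) : Set (Lit α) :=
  Lit.pos '' X ∪ Lit.neg '' (herbrandDn P \ X)

@[simp]
theorem pos_mem_completion {P : Set (DnRule α)} {X : Set α} {a : α} :
    Lit.pos a ∈ completion P X ↔ a ∈ X := by
  simp [completion]

@[simp]
theorem neg_mem_completion {P : Set (DnRule α)} {X : Set α} {a : α} :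
    Lit.neg a ∈ completion P X ↔ a ∈ herbrandDn P ∧ a ∉ X := by
  simp [completion]

theorem mem_herbrandDn_of_mem_head {P : Set (DnRule α)} {r : DnRule α} (hr : r ∈ P) {a : α}
    (ha : a ∈ r.head) : a ∈ herbrandDn P :=
  ⟨r, hr, Or.inl ha⟩

theorem mem_herbrandDn_of_mem_bodyNaf {P : Set (DnRule α)} {r : DnRule α} (hr : r ∈ P) {a : α}
    (ha : a ∈ r.bodyNaf) : a ∈ herbrandDn P :=
  ⟨r, hr, Or.inr (Or.inr ha)⟩

theorem coe_DnBody_subset_iff {r : DnRule α} {I : Set (Lit α)} :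
    (↑(DnBody r) : Set (Lit α)) ⊆ I ↔
      (∀ b ∈ r.bodyPos, Lit.pos b ∈ I) ∧ ∀ b ∈ r.bodyNaf, Lit.neg b ∈ I := by
  simp [DnBody, Set.subset_def, or_imp, forall_and]

theorem coe_DnBody_subset_completion_iff {P : Set (DnRule α)} {r : DnRule α} (hr : r ∈ P)
    {X : Set α} : (↑(DnBody r) : Set (Lit α)) ⊆ completion P X ↔
      (∀ b ∈ r.bodyPos, b ∈ X) ∧ ∀ b ∈ r.bodyNaf, b ∉ X := by
  simp only [coe_DnBody_subset_iff, pos_mem_completion, neg_mem_completion]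
  exact and_congr_right fun _ => forall₂_congr fun b hb =>
    and_iff_right (mem_herbrandDn_of_mem_bodyNaf hr hb)

theorem coe_DnBody_union_subset_completion_iff {P : Set (DnRule α)} {r : DnRule α} (hr : r ∈ P)
    {X : Set α} {a : α} :
    (↑(DnBody r ∪ (r.head.erase a).image Lit.neg) : Set (Lit α)) ⊆ completion P X ↔
      ((∀ b ∈ r.bodyPos, b ∈ X) ∧ ∀ b ∈ r.bodyNaf, b ∉ X) ∧
        ∀ b ∈ r.head, b ≠ a → b ∉ X := by
  rw [Finset.coe_union, Set.union_subset_iff, coe_DnBody_subset_completion_iff hr]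
  refine and_congr_right fun _ => ?_
  rw [Finset.coe_image, Set.image_subset_iff]
  constructor
  · exact fun h b hb hba => (neg_mem_completion.1 (h (Finset.mem_erase.2 ⟨hba, hb⟩))).2
  · intro h b hb
    obtain ⟨hba, hb⟩ := Finset.mem_erase.1 hb
    exact neg_mem_completion.2 ⟨mem_herbrandDn_of_mem_head hr hb, h b hb hba⟩

theorem satisfied_some_iff {I : Set (Lit α)} {l : Lit α} {B : Finset (Lit α)} :
    Satisfied I ⟨some l, B⟩ ↔ (↑B ⊆ I → l ∈ I) := by
  simp [Satisfied]

theorem satisfied_DnPminus_iff {I : Set (Lit α)} {a : α} :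
    Satisfied I ⟨some (Lit.neg a), ∅⟩ ↔ Lit.neg a ∈ I := by
  simp [satisfied_some_iff]

theorem satisfied_DnPp_completion_iff {P : Set (DnRule α)} {X : Set α} :
    (∀ t ∈ DnPp P, Satisfied (completion P X) t) ↔
      ∀ r ∈ P, r.head.Nonempty → (∀ b ∈ r.bodyPos, b ∈ X) → (∀ b ∈ r.bodyNaf, b ∉ X) →
        ∃ a ∈ r.head, a ∈ X := by
  constructor
  · rintro h r hr ⟨a, ha⟩ hpos hnaf
    by_contra! hX
    have := satisfied_some_iff.1 (h _ ⟨r, hr, a, ha, rfl⟩)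
      ((coe_DnBody_union_subset_completion_iff hr).2 ⟨⟨hpos, hnaf⟩, fun b hb _ => hX b hb⟩)
    exact hX a ha (pos_mem_completion.1 this)
  · rintro h _ ⟨r, hr, a, ha, rfl⟩
    rw [satisfied_some_iff, coe_DnBody_union_subset_completion_iff hr, pos_mem_completion]
    rintro ⟨⟨hpos, hnaf⟩, hne⟩
    obtain ⟨b, hb, hbX⟩ := h r hr ⟨a, ha⟩ hpos hnaf
    by_contra haX
    exact hne b hb (fun hba => haX (hba ▸ hbX)) hbX

theorem dModel_DnGLreduct_iff {P : Set (DnRule α)} {M X : Set α} :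
    DModel (DnGLreduct P M) X ↔
      ∀ r ∈ P, (∀ b ∈ r.bodyNaf, b ∉ M) → (∀ b ∈ r.bodyPos, b ∈ X) → ∃ a ∈ r.head, a ∈ X := by
  constructor
  · exact fun h r hr hnaf hpos => h _ ⟨r, hr, hnaf, rfl⟩ hpos
  · rintro h _ ⟨r, hr, hnaf, rfl⟩ hpos
    exact h r hr hnaf hpos

theorem DnAnswerSet.exists_head_mem {P : Set (DnRule α)} {M : Set α} (hM : DnAnswerSet P M)
    {r : DnRule α} (hr : r ∈ P) (hpos : ∀ b ∈ r.bodyPos, b ∈ M) (hnaf : ∀ b ∈ r.bodyNaf, b ∉ M) :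
    ∃ a ∈ r.head, a ∈ M :=
  dModel_DnGLreduct_iff.1 hM.1 r hr hnaf hpos

theorem DnAnswerSet.eq_of_subset {P : Set (DnRule α)} {M X : Set α} (hM : DnAnswerSet P M)
    (hXM : X ⊆ M) (hX : DModel (DnGLreduct P M) X) : X = M :=
  hXM.antisymm <| by_contra fun h => hM.2 X hX ⟨hXM, h⟩

/-- Every atom of an answer set is the only true head atom of some rule with a true body. -/
theorem DnAnswerSet.exists_supporting_rule {P : Set (DnRule α)} {M : Set α}
    (hM : DnAnswerSet P M) {a : α} (ha : a ∈ M) :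
    ∃ r ∈ P, a ∈ r.head ∧ ((∀ b ∈ r.bodyPos, b ∈ M) ∧ ∀ b ∈ r.bodyNaf, b ∉ M) ∧
      ∀ b ∈ r.head, b ≠ a → b ∉ M := by
  have hnot : ¬ DModel (DnGLreduct P M) (M \ {a}) := fun h =>
    hM.2 _ h (Set.sdiff_singleton_ssubset.2 ha)
  rw [dModel_DnGLreduct_iff] at hnot
  push Not at hnot
  obtain ⟨r, hr, hnaf, hpos, hhead⟩ := hnot
  have hpos' : ∀ b ∈ r.bodyPos, b ∈ M := fun b hb => (hpos b hb).1
  have hne : ∀ b ∈ r.head, b ≠ a → b ∉ M := fun b hb hba hbM => hhead b hb ⟨hbM, hba⟩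
  obtain ⟨c, hc, hcM⟩ := hM.exists_head_mem hr hpos' hnaf
  obtain rfl : c = a := by_contra fun hca => hne c hc hca hcM
  exact ⟨r, hr, hc, ⟨hpos', hnaf⟩, hne⟩

theorem DnAnswerSet.subset_herbrandDn {P : Set (DnRule α)} {M : Set α} (hM : DnAnswerSet P M) :
    M ⊆ herbrandDn P := fun _ ha =>
  let ⟨_, hr, har, _⟩ := hM.exists_supporting_rule ha
  mem_herbrandDn_of_mem_head hr har

theorem DnAnswerSet.satisfied_DnPp {P : Set (DnRule α)} {M : Set α} (hM : DnAnswerSet P M) :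
    ∀ t ∈ DnPp P, Satisfied (completion P M) t :=
  satisfied_DnPp_completion_iff.2 fun _ hr _ hpos hnaf => hM.exists_head_mem hr hpos hnaf

theorem DnPc_subset_DnProg {P : Set (DnRule α)} : DnPc P ⊆ DnProg P := fun _ h =>
  Or.inl (Or.inl h)

theorem DnPminus_subset_DnProg {P : Set (DnRule α)} : DnPminus P ⊆ DnProg P := fun _ h =>
  Or.inl (Or.inr h)

theorem DnPp_subset_DnProg {P : Set (DnRule α)} : DnPp P ⊆ DnProg P := fun _ h => Or.inr h

theorem herbrand_DnProg (P : Set (DnRule α)) : herbrand (DnProg P) = herbrandDn P := by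
  ext a
  constructor
  · rintro ⟨t, (⟨r, hr, c, hc, rfl⟩ | ⟨c, hc, rfl⟩) | ⟨r, hr, c, hc, rfl⟩,
      ⟨l, hl, rfl⟩ | ⟨l, hl, rfl⟩⟩
    · cases hl
      exact mem_herbrandDn_of_mem_head hr hc
    · simp only [DnBody, Finset.mem_union, Finset.mem_image] at hl
      rcases hl with ⟨b, hb, rfl⟩ | ⟨b, hb, rfl⟩
      · exact ⟨r, hr, Or.inr (Or.inl hb)⟩
      · exact mem_herbrandDn_of_mem_bodyNaf hr hb
    · cases hl
      exact hc
    · simp at hl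
    · cases hl
      exact mem_herbrandDn_of_mem_head hr hc
    · simp only [DnBody, Finset.mem_union, Finset.mem_image] at hl
      rcases hl with (⟨b, hb, rfl⟩ | ⟨b, hb, rfl⟩) | ⟨b, hb, rfl⟩
      · exact ⟨r, hr, Or.inr (Or.inl hb)⟩
      · exact mem_herbrandDn_of_mem_bodyNaf hr hb
      · exact mem_herbrandDn_of_mem_head hr (Finset.mem_of_mem_erase hb)
  · exact fun ha => ⟨_, DnPminus_subset_DnProg ⟨a, ha, rfl⟩, Or.inl ⟨_, rfl, rfl⟩⟩

theorem isInterp_completion {P : Set (DnRule α)} {X : Set α} (hX : X ⊆ herbrandDn P) :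
    IsInterp (DnProg P) (completion P X) := by
  refine ⟨fun a ⟨hp, hn⟩ => (neg_mem_completion.1 hn).2 (pos_mem_completion.1 hp), ?_⟩
  rw [herbrand_DnProg]
  rintro (a | a) h
  · exact hX (pos_mem_completion.1 h)
  · exact (neg_mem_completion.1 h).1

theorem DnAnswerSet.founded_completion {P : Set (DnRule α)} {M : Set α} (hM : DnAnswerSet P M) :
    Founded (DnProg P) (completion P M) := by
  refine Set.Subset.antisymm (Set.sInter_subset_of_mem ?_) (Set.subset_sInter ?_)
  · rintro r ⟨-, hr⟩ hb l hl
    obtain ⟨l', hl', hmem⟩ := hr hb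
    rw [hl, Option.some.injEq] at hl'
    exact hl' ▸ hmem
  · intro J hJ
    have hneg : ∀ a ∈ herbrandDn P, a ∉ M → Lit.neg a ∈ J := fun a ha haM =>
      hJ _ ⟨DnPminus_subset_DnProg ⟨a, ha, rfl⟩,
        satisfied_DnPminus_iff.2 (neg_mem_completion.2 ⟨ha, haM⟩)⟩ (by simp) _ rfl
    have hpos : {a ∈ M | Lit.pos a ∈ J} = M := by
      refine hM.eq_of_subset (Set.sep_subset _ _) (dModel_DnGLreduct_iff.2 ?_)
      intro r hr hnaf hbody
      obtain ⟨a, ha, haM⟩ := hM.exists_head_mem hr (fun b hb => (hbody b hb).1) hnaf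
      refine ⟨a, ha, haM, hJ _ ⟨DnPc_subset_DnProg ⟨r, hr, a, ha, rfl⟩,
        satisfied_some_iff.2 fun _ => pos_mem_completion.2 haM⟩ ?_ _ rfl⟩
      exact coe_DnBody_subset_iff.2 ⟨fun b hb => (hbody b hb).2, fun b hb =>
        hneg b (mem_herbrandDn_of_mem_bodyNaf hr hb) (hnaf b hb)⟩
    rintro (a | a) h
    · rw [pos_mem_completion, ← hpos] at h
      exact h.2
    · rw [neg_mem_completion] at h
      exact hneg a h.1 h.2

theorem DnAnswerSet.extAnswerSet_completion {P : Set (DnRule α)} {M : Set α}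
    (hM : DnAnswerSet P M) : ExtAnswerSet (DnProg P) (completion P M) := by
  refine ⟨isInterp_completion hM.subset_herbrandDn, hM.founded_completion, ?_⟩
  rintro t ((⟨r, hr, a, ha, rfl⟩ | ⟨a, ha, rfl⟩) | ht)
  · have haH := mem_herbrandDn_of_mem_head hr ha
    by_cases haM : a ∈ M
    · exact Or.inl (satisfied_some_iff.2 fun _ => pos_mem_completion.2 haM)
    · exact Or.inr ⟨_, rfl, _, DnPminus_subset_DnProg ⟨a, haH, rfl⟩, rfl, by simp, _, rfl,
        neg_mem_completion.2 ⟨haH, haM⟩⟩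
  · by_cases haM : a ∈ M
    · obtain ⟨r, hr, har, hbody⟩ := hM.exists_supporting_rule haM
      exact Or.inr ⟨_, rfl, _, DnPp_subset_DnProg ⟨r, hr, a, har, rfl⟩, rfl,
        (coe_DnBody_union_subset_completion_iff hr).2 hbody, _, rfl, pos_mem_completion.2 haM⟩
    · exact Or.inl (satisfied_DnPminus_iff.2 (neg_mem_completion.2 ⟨ha, haM⟩))
  · exact Or.inl (hM.satisfied_DnPp t ht)

/-- Extended answer sets of `D_n(P)` are total. -/
theorem ExtAnswerSet.eq_completion {P : Set (DnRule α)} {N : Set (Lit α)}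
    (hN : ExtAnswerSet (DnProg P) N) : N = completion P {a | Lit.pos a ∈ N} := by
  obtain ⟨⟨hcons, hbase⟩, -, hsat⟩ := hN
  rw [herbrand_DnProg] at hbase
  ext (a | a)
  · simp
  · rw [neg_mem_completion]
    refine ⟨fun h => ⟨hbase _ h, fun hp => hcons a ⟨hp, h⟩⟩, fun ⟨ha, hna⟩ => ?_⟩
    rcases hsat _ (DnPminus_subset_DnProg ⟨a, ha, rfl⟩) with h | ⟨l, hl, t, -, ht, -, l', hl', hmem⟩
    · exact satisfied_DnPminus_iff.1 h
    · cases hl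
      rw [ht] at hl'
      cases hl'
      exact absurd hmem hna

/-- An extended answer set of `D_n(P)` that violates a rule of `P_p` is not preferred to the
completion of an answer set, since that completion satisfies all of `P_p`. -/
theorem DnAnswerSet.asSq_of_not_satisfied_DnPp {P : Set (DnRule α)} {M : Set α}
    (hM : DnAnswerSet P M) {N : Set (Lit α)} {t : Rule α} (ht : t ∈ DnPp P)
    (htN : ¬ Satisfied N t) : ASSq (DnProg P) (Dnlt P) (completion P M) N := by
  rintro s ⟨⟨hs, -⟩, hsM⟩
  refine ⟨t, ⟨⟨DnPp_subset_DnProg ht, hM.satisfied_DnPp t ht⟩, fun h => htN h.2⟩,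
    Or.inl ⟨ht, ?_⟩⟩
  rcases hs with (hc | hm) | hp
  · exact Or.inr hc
  · exact Or.inl hm
  · exact absurd ⟨DnPp_subset_DnProg hp, hM.satisfied_DnPp s hp⟩ hsM

theorem DnAnswerSet.eq_of_asSq {P : Set (DnRule α)} {M X : Set α} (hM : DnAnswerSet P M)
    (hX : ∀ t ∈ DnPp P, Satisfied (completion P X) t) (hXH : X ⊆ herbrandDn P)
    (hle : ASSq (DnProg P) (Dnlt P) (completion P X) (completion P M)) : X = M := by
  have hXM : X ⊆ M := by
    intro a haX
    by_contra haM
    have ha := hXH haX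
    obtain ⟨t, ⟨-, htM⟩, ⟨ht, -⟩ | ⟨-, _, -, _, -, heq⟩⟩ :=
      hle ⟨some (Lit.neg a), ∅⟩ ⟨⟨DnPminus_subset_DnProg ⟨a, ha, rfl⟩,
        satisfied_DnPminus_iff.2 (neg_mem_completion.2 ⟨ha, haM⟩)⟩,
        fun h => (neg_mem_completion.1 (satisfied_DnPminus_iff.1 h.2)).2 haX⟩
    · exact htM ⟨DnPp_subset_DnProg ht, hM.satisfied_DnPp t ht⟩
    · simp at heq
  refine hM.eq_of_subset hXM (dModel_DnGLreduct_iff.2 fun r hr hnaf hpos => ?_)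
  obtain ⟨a, ha, -⟩ := hM.exists_head_mem hr (fun b hb => hXM (hpos b hb)) hnaf
  exact satisfied_DnPp_completion_iff.1 hX r hr ⟨a, ha⟩ hpos fun b hb hbX => hnaf b hb (hXM hbX)

theorem DnAnswerSet.preferredAS_completion {P : Set (DnRule α)} {M : Set α}
    (hM : DnAnswerSet P M) : PreferredAS (DnProg P) (Dnlt P) (completion P M) := by
  refine ⟨hM.extAnswerSet_completion, fun N hN ⟨hle, hnle⟩ => hnle ?_⟩
  by_cases hNp : ∀ t ∈ DnPp P, Satisfied N t
  · have hNeq := hN.eq_completion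
    have hXH : {a | Lit.pos a ∈ N} ⊆ herbrandDn P := fun a ha =>
      herbrand_DnProg P ▸ hN.1.2 (Lit.pos a) ha
    rw [hNeq] at hle hNp
    rw [hNeq, hM.eq_of_asSq hNp hXH hle]
    exact fun t ht => absurd ht.1 ht.2
  · push Not at hNp
    obtain ⟨t, ht, htN⟩ := hNp
    exact hM.asSq_of_not_satisfied_DnPp ht htN

theorem DnAnswerSet.properAS_completion {P : Set (DnRule α)} {M : Set α}
    (hM : DnAnswerSet P M) : ProperAS (DnProg P) (Dnlt P) (completion P M) := by
  rintro t ((⟨r, hr, a, ha, rfl⟩ | ⟨a, ha, rfl⟩) | ht) hmin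
  · have hp : _ ∈ DnPp P := ⟨r, hr, a, ha, rfl⟩
    exact absurd (Or.inl ⟨hp, Or.inr ⟨r, hr, a, ha, rfl⟩⟩) (hmin _ (DnPp_subset_DnProg hp))
  · refine satisfied_DnPminus_iff.2 (neg_mem_completion.2 ⟨ha, fun haM => ?_⟩)
    obtain ⟨r, hr, har, -⟩ := hM.exists_supporting_rule haM
    have hp : _ ∈ DnPp P := ⟨r, hr, a, har, rfl⟩
    exact hmin _ (DnPp_subset_DnProg hp) (Or.inl ⟨hp, Or.inl ⟨a, ha, rfl⟩⟩)
  · exact hM.satisfied_DnPp t ht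

end Completion

/-- If `M` is an answer set of the seminegative disjunctive
program `P` then `M ∪ ¬(H_B(P) \ M)` is a proper preferred answer set of
`D_n(P)`. -/
theorem dnAnswerSet_proper_preferred_DnProg
    {α : Type} [DecidableEq α] (P : Set (DnRule α)) (hP : P.Countable)
    (M : Set α) (hM : DnAnswerSet P M) :
    PreferredAS (DnProg P) (Dnlt P)
        (Lit.pos '' M ∪ Lit.neg '' (herbrandDn P \ M)) ∧
      ProperAS (DnProg P) (Dnlt P)
        (Lit.pos '' M ∪ Lit.neg '' (herbrandDn P \ M)) := by
  exact ⟨hM.preferredAS_completion, hM.properAS_completion⟩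

end ASP
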